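/- Let b be a positive integer, λ ∈ ℂ, and set D(t) = t^{4b} + t^b + λ. If (u_n, v_n) are the convergents to √(t⁴ + t + λ), then (u_n(t^b), v_n(t^b)) are (up to normalization) convergents to √(D(t)), and the corresponding partial quotients have degree ≥ b = deg(D)/4. -/

import Mathlib

open Polynomial

/-- An abstract model of the field `ℂ((t⁻¹))` of formal Laurent series at `t = ∞`:
`ι` embeds the rational functions `ℂ(t)`, `v f` is the order of vanishing of `f` at
`t = ∞` (so `v p = -deg p` for a nonzero polynomial `p`), and `polyPart f` is the
polynomial part of `f` (the unique polynomial `g` with `f - g` vanishing at `∞`). -/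
structure LaurentAtInfModel (F : Type*) [Field F] where
  ι : RatFunc ℂ →+* F
  v : F → ℤ
  polyPart : F → ℂ[X]
  v_mul : ∀ f g : F, f ≠ 0 → g ≠ 0 → v (f * g) = v f + v g
  v_add : ∀ f g : F, f ≠ 0 → g ≠ 0 → f + g ≠ 0 → min (v f) (v g) ≤ v (f + g)
  v_poly : ∀ p : ℂ[X], p ≠ 0 → v (ι (algebraMap ℂ[X] (RatFunc ℂ) p)) = -(p.natDegree : ℤ)
  polyPart_spec : ∀ f : F,
      f - ι (algebraMap ℂ[X] (RatFunc ℂ) (polyPart f)) = 0 ∨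
        1 ≤ v (f - ι (algebraMap ℂ[X] (RatFunc ℂ) (polyPart f)))
  polyPart_unique : ∀ (f : F) (g : ℂ[X]),
      (f - ι (algebraMap ℂ[X] (RatFunc ℂ) g) = 0 ∨
        1 ≤ v (f - ι (algebraMap ℂ[X] (RatFunc ℂ) g))) → g = polyPart f

namespace LaurentAtInfModel

variable {F : Type*} [Field F] (M : LaurentAtInfModel F)

/-- The image of a polynomial in the model. -/
noncomputable def ofPoly (p : ℂ[X]) : F := M.ι (algebraMap ℂ[X] (RatFunc ℂ) p)

/-- The complete quotients (tails) `λ_n` of the continued fraction of `lam`: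
`λ₀ = lam`, `λ_{n+1} = 1 / (λ_n - a_n)`. -/
noncomputable def tail (lam : F) : ℕ → F
  | 0 => lam
  | n + 1 => (tail lam n - M.ofPoly (M.polyPart (tail lam n)))⁻¹

/-- The partial quotients `a_n` of the continued fraction of `lam`. -/
noncomputable def pq (lam : F) (n : ℕ) : ℂ[X] := M.polyPart (M.tail lam n)

/-- The convergent numerators `p_n`, computed formally from the partial quotients in
the standard way, with `(p₀, q₀) = (1, 0)`: `p_{n+1} = a_n p_n + p_{n-1}`. -/
noncomputable def num (lam : F) : ℕ → ℂ[X]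
  | 0 => 1
  | 1 => M.pq lam 0
  | n + 2 => M.pq lam (n + 1) * num lam (n + 1) + num lam n

/-- The convergent denominators `q_n`: `q_{n+1} = a_n q_n + q_{n-1}`. -/
noncomputable def den (lam : F) : ℕ → ℂ[X]
  | 0 => 0
  | 1 => 1
  | n + 2 => M.pq lam (n + 1) * den lam (n + 1) + den lam n

/-- `lam ∈ ℂ((t⁻¹))` is irrational: not a rational function of `t`. -/
def Irrational (lam : F) : Prop := ∀ r : RatFunc ℂ, lam ≠ M.ι r

end LaurentAtInfModel

namespace LaurentAtInfModel

variable {F : Type*} [Field F] {M : LaurentAtInfModel F}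

lemma Irrational.sub_ofPoly_ne_zero {f : F} (hf : M.Irrational f)
    (p : ℂ[X]) : f - M.ofPoly p ≠ 0 :=
  fun h => hf _ (sub_eq_zero.mp h)

lemma Irrational.ne_zero {f : F} (hf : M.Irrational f) : f ≠ 0 :=
  fun h => hf 0 (by simpa using h)

lemma Irrational.tail {f : F} (hf : M.Irrational f) (n : ℕ) :
    M.Irrational (M.tail f n) := by
  induction n with
  | zero => exact hf
  | succ n ih =>
    intro r hr
    apply ih (r⁻¹ + algebraMap ℂ[X] (RatFunc ℂ) (M.polyPart (M.tail f n)))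
    rw [LaurentAtInfModel.tail, inv_eq_iff_eq_inv, ← map_inv₀] at hr
    rw [map_add, ← hr]
    exact (sub_add_cancel _ _).symm

variable (M)

lemma v_ofPoly {p : ℂ[X]} (hp : p ≠ 0) : M.v (M.ofPoly p) = -(p.natDegree : ℤ) :=
  M.v_poly p hp

lemma v_one : M.v 1 = 0 := by
  simpa [ofPoly] using M.v_ofPoly (one_ne_zero (α := ℂ[X]))

lemma v_inv {f : F} (hf : f ≠ 0) : M.v f⁻¹ = -M.v f := by
  have h := M.v_mul f f⁻¹ hf (inv_ne_zero hf)
  rw [mul_inv_cancel₀ hf, M.v_one] at h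
  linarith

/-- The polynomial part of a series with a pole at infinity is nonconstant. -/
lemma one_le_natDegree_polyPart {f : F} (hf : f ≠ 0) (hv : M.v f ≤ -1) :
    1 ≤ (M.polyPart f).natDegree := by
  by_contra! hdeg
  have h0 : (M.polyPart f).natDegree = 0 := by omega
  have hspec : f - M.ofPoly (M.polyPart f) = 0 ∨ 1 ≤ M.v (f - M.ofPoly (M.polyPart f)) :=
    M.polyPart_spec f
  by_cases hp : M.polyPart f = 0
  · have hz : M.ofPoly (M.polyPart f) = 0 := by simp [ofPoly, hp]
    rw [hz, sub_zero] at hspec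
    rcases hspec with h | h
    · exact hf h
    · omega
  · have hvp : M.v (M.ofPoly (M.polyPart f)) = 0 := by simp [M.v_ofPoly hp, h0]
    by_cases hd : f - M.ofPoly (M.polyPart f) = 0
    · rw [← sub_eq_zero.mp hd] at hvp
      omega
    · have hq : M.ofPoly (M.polyPart f) ≠ 0 := by
        simpa [ofPoly] using hp
      have hadd := M.v_add _ _ hd hq (by simpa using hf)
      rw [sub_add_cancel, hvp] at hadd
      have := hspec.resolve_left hd
      omega

/-- Every complete quotient after the first has a pole at infinity. -/
lemma v_tail_succ_le {f : F} (hf : M.Irrational f) (n : ℕ) : M.v (M.tail f (n + 1)) ≤ -1 := by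
  have hne := (hf.tail n).sub_ofPoly_ne_zero (M.polyPart (M.tail f n))
  have h : 1 ≤ M.v (M.tail f n - M.ofPoly (M.polyPart (M.tail f n))) :=
    (M.polyPart_spec (M.tail f n)).resolve_left hne
  rw [tail, M.v_inv hne]
  omega

lemma one_le_natDegree_pq {f : F} (hf : M.Irrational f) (hv : M.v f ≤ -1) (n : ℕ) :
    1 ≤ (M.pq f n).natDegree := by
  refine M.one_le_natDegree_polyPart (hf.tail n).ne_zero ?_
  cases n with
  | zero => exact hv
  | succ n => exact M.v_tail_succ_le hf n

variable {M}

lemma polyPart_map {b : ℕ} (hb : 0 < b) {σ : F →+* F}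
    (hσpoly : ∀ r : ℂ[X], σ (M.ofPoly r) = M.ofPoly (r.comp (X ^ b)))
    (hσv : ∀ f : F, f ≠ 0 → M.v (σ f) = (b : ℤ) * M.v f) (f : F) :
    M.polyPart (σ f) = (M.polyPart f).comp (X ^ b) := by
  refine (M.polyPart_unique _ _ ?_).symm
  change σ f - M.ofPoly _ = 0 ∨ 1 ≤ M.v (σ f - M.ofPoly _)
  rw [← hσpoly, ← map_sub]
  by_cases h : f - M.ofPoly (M.polyPart f) = 0
  · exact Or.inl (by rw [h, map_zero])
  · have h1 : 1 ≤ M.v (f - M.ofPoly (M.polyPart f)) := (M.polyPart_spec f).resolve_left h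
    rw [hσv _ h]
    exact Or.inr (one_le_mul_of_one_le_of_one_le (by exact_mod_cast hb) h1)

lemma tail_map {b : ℕ} (hb : 0 < b) {σ : F →+* F}
    (hσpoly : ∀ r : ℂ[X], σ (M.ofPoly r) = M.ofPoly (r.comp (X ^ b)))
    (hσv : ∀ f : F, f ≠ 0 → M.v (σ f) = (b : ℤ) * M.v f) (f : F) (n : ℕ) :
    M.tail (σ f) n = σ (M.tail f n) := by
  induction n with
  | zero => rfl
  | succ n ih => rw [tail, tail, ih, polyPart_map hb hσpoly hσv, map_inv₀, map_sub, hσpoly]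

lemma pq_map {b : ℕ} (hb : 0 < b) {σ : F →+* F}
    (hσpoly : ∀ r : ℂ[X], σ (M.ofPoly r) = M.ofPoly (r.comp (X ^ b)))
    (hσv : ∀ f : F, f ≠ 0 → M.v (σ f) = (b : ℤ) * M.v f) (f : F) (n : ℕ) :
    M.pq (σ f) n = (M.pq f n).comp (X ^ b) := by
  rw [pq, pq, tail_map hb hσpoly hσv, polyPart_map hb hσpoly hσv]

lemma num_map {b : ℕ} (hb : 0 < b) {σ : F →+* F}
    (hσpoly : ∀ r : ℂ[X], σ (M.ofPoly r) = M.ofPoly (r.comp (X ^ b)))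
    (hσv : ∀ f : F, f ≠ 0 → M.v (σ f) = (b : ℤ) * M.v f) (f : F) (n : ℕ) :
    M.num (σ f) n = (M.num f n).comp (X ^ b) := by
  induction n using Nat.twoStepInduction with
  | zero => simp [num]
  | one => exact pq_map hb hσpoly hσv f 0
  | more n ih₀ ih₁ => simp [num, ih₀, ih₁, pq_map hb hσpoly hσv]

lemma den_map {b : ℕ} (hb : 0 < b) {σ : F →+* F}
    (hσpoly : ∀ r : ℂ[X], σ (M.ofPoly r) = M.ofPoly (r.comp (X ^ b)))
    (hσv : ∀ f : F, f ≠ 0 → M.v (σ f) = (b : ℤ) * M.v f) (f : F) (n : ℕ) :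
    M.den (σ f) n = (M.den f n).comp (X ^ b) := by
  induction n using Nat.twoStepInduction with
  | zero => simp [den]
  | one => simp [den]
  | more n ih₀ ih₁ => simp [den, ih₀, ih₁, pq_map hb hσpoly hσv]

end LaurentAtInfModel

/-- Let `b` be a positive integer, `μ ∈ ℂ`, and set `D(t) = t^{4b} + t^b + μ`, which is
`E(t^b)` for `E(t) = t⁴ + t + μ`.  If `(u_n, v_n)` are the convergents to `√E`, then
`(u_n(t^b), v_n(t^b))` are (up to normalization by a nonzero constant `c`) convergents
to `√D`, and the corresponding partial quotients have degree `≥ b = deg D / 4`.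

The substitution `t ↦ t^b` is encoded by the ring endomorphism `σ` of the model, which
carries a polynomial `r(t)` to `r(t^b)`, carries `√E` to `√D`, and multiplies the order
of vanishing at infinity by `b`. -/
theorem statement13 {F : Type*} [Field F] (M : LaurentAtInfModel F)
    (b : ℕ) (hb : 0 < b) (μ : ℂ)
    (E : Polynomial ℂ) (hE : E = X ^ 4 + X + C μ)
    (D : Polynomial ℂ) (hD : D = X ^ (4 * b) + X ^ b + C μ)
    (hEnonsq : ¬∃ g : Polynomial ℂ, E = g ^ 2)
    (wE wD : F) (hwE : wE ^ 2 = M.ofPoly E) (hwD : wD ^ 2 = M.ofPoly D)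
    (hirrE : M.Irrational wE) (hirrD : M.Irrational wD)
    (σ : F →+* F)
    (hσpoly : ∀ r : Polynomial ℂ, σ (M.ofPoly r) = M.ofPoly (r.comp (X ^ b)))
    (hσw : σ wE = wD)
    (hσv : ∀ f : F, f ≠ 0 → M.v (σ f) = (b : ℤ) * M.v f) :
    ∀ n : ℕ, ∃ (m : ℕ) (c : ℂ), c ≠ 0 ∧
      (M.num wE n).comp (X ^ b) = C c * M.num wD m ∧
      (M.den wE n).comp (X ^ b) = C c * M.den wD m ∧
      b ≤ (M.pq wD m).natDegree := by
  intro n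
  have hvE : M.v wE ≤ -1 := by
    have hdeg : E.natDegree = 4 := by rw [hE]; compute_degree!
    have hE0 : E ≠ 0 := by rintro rfl; simp at hdeg
    have h := M.v_mul wE wE hirrE.ne_zero hirrE.ne_zero
    rw [← sq, hwE, M.v_ofPoly hE0, hdeg] at h
    omega
  subst hσw
  refine ⟨n, 1, one_ne_zero, ?_, ?_, ?_⟩
  · rw [C_1, one_mul, LaurentAtInfModel.num_map hb hσpoly hσv]
  · rw [C_1, one_mul, LaurentAtInfModel.den_map hb hσpoly hσv]
  · rw [LaurentAtInfModel.pq_map hb hσpoly hσv, natDegree_comp, natDegree_X_pow]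
    exact Nat.le_mul_of_pos_left b (M.one_le_natDegree_pq hirrE hvE n)
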